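/- Let m, n be positive integers and define f : ℝ² → ℝ by f(x,y) := x^m − y^n. Then f has a saddle point at (0,0) if and only if both m and n are even. -/

import Mathlib

open Set Filter Topology

/-- `γ : [a, b] → D` is a regular path in `D`: it is continuous on `[a, b]`, maps `[a, b]`
into `D`, is differentiable on `(a, b)`, and its derivative is nonvanishing on `(a, b)`. -/
def IsRegularPath (D : Set (ℝ × ℝ)) (γ : ℝ → ℝ × ℝ) (a b : ℝ) : Prop :=
  a < b ∧ ContinuousOn γ (Set.Icc a b) ∧ Set.MapsTo γ (Set.Icc a b) D ∧
    ∀ t ∈ Set.Ioo a b, DifferentiableAt ℝ γ t ∧ deriv γ t ≠ 0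

/-- A function of one real variable has a strict local maximum at `t`. -/
def IsStrictLocalMax (g : ℝ → ℝ) (t : ℝ) : Prop :=
  ∀ᶠ s in 𝓝[≠] t, g s < g t

/-- A function of one real variable has a strict local minimum at `t`. -/
def IsStrictLocalMin (g : ℝ → ℝ) (t : ℝ) : Prop :=
  ∀ᶠ s in 𝓝[≠] t, g t < g s

/-- `f` has a saddle point at `p`: there are regular paths `γ₁, γ₂` in `D` passing through `p`
and intersecting transversally at `p` (their tangent vectors at `p` are not multiples of each
other) such that `f` has a local maximum at `p` along `γ₁` and a local minimum at `p`
along `γ₂`. -/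
def HasSaddleAt (D : Set (ℝ × ℝ)) (f : ℝ × ℝ → ℝ) (p : ℝ × ℝ) : Prop :=
  ∃ (a₁ b₁ a₂ b₂ t₁ t₂ : ℝ) (γ₁ γ₂ : ℝ → ℝ × ℝ),
    IsRegularPath D γ₁ a₁ b₁ ∧ IsRegularPath D γ₂ a₂ b₂ ∧
    t₁ ∈ Set.Ioo a₁ b₁ ∧ t₂ ∈ Set.Ioo a₂ b₂ ∧ γ₁ t₁ = p ∧ γ₂ t₂ = p ∧
    (∀ c : ℝ, deriv γ₁ t₁ ≠ c • deriv γ₂ t₂) ∧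
    (∀ c : ℝ, deriv γ₂ t₂ ≠ c • deriv γ₁ t₁) ∧
    IsLocalMax (f ∘ γ₁) t₁ ∧ IsLocalMin (f ∘ γ₂) t₂

/-- `f` has a strict saddle point at `p`: as for a saddle point, but with a strict local
maximum along `γ₁` and a strict local minimum along `γ₂`. -/
def HasStrictSaddleAt (D : Set (ℝ × ℝ)) (f : ℝ × ℝ → ℝ) (p : ℝ × ℝ) : Prop :=
  ∃ (a₁ b₁ a₂ b₂ t₁ t₂ : ℝ) (γ₁ γ₂ : ℝ → ℝ × ℝ),
    IsRegularPath D γ₁ a₁ b₁ ∧ IsRegularPath D γ₂ a₂ b₂ ∧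
    t₁ ∈ Set.Ioo a₁ b₁ ∧ t₂ ∈ Set.Ioo a₂ b₂ ∧ γ₁ t₁ = p ∧ γ₂ t₂ = p ∧
    (∀ c : ℝ, deriv γ₁ t₁ ≠ c • deriv γ₂ t₂) ∧
    (∀ c : ℝ, deriv γ₂ t₂ ≠ c • deriv γ₁ t₁) ∧
    IsStrictLocalMax (f ∘ γ₁) t₁ ∧ IsStrictLocalMin (f ∘ γ₂) t₂

lemma aux_tendsto (X Y : ℝ → ℝ) (a b t : ℝ) (hX : HasDerivAt X a t) (hY : HasDerivAt Y b t)
    (hX0 : X t = 0) (hY0 : Y t = 0) (m n k : ℕ) (hkm : k ≤ m) (hkn : k ≤ n) :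
    Tendsto (fun s => (X s ^ m - Y s ^ n) / (s - t) ^ k) (𝓝[≠] t)
      (𝓝 (a ^ m * 0 ^ (m - k) - b ^ n * 0 ^ (n - k))) := by
  rw [hasDerivAt_iff_tendsto_slope] at hX hY
  have h0 : Tendsto (fun s : ℝ => s - t) (𝓝[≠] t) (𝓝 0) := by
    have : Tendsto (fun s : ℝ => s - t) (𝓝 t) (𝓝 (t - t)) :=
      (continuous_id.sub continuous_const).tendsto t
    rw [sub_self] at this
    exact this.mono_left nhdsWithin_le_nhds
  have H := ((hX.pow m).mul (h0.pow (m - k))).sub ((hY.pow n).mul (h0.pow (n - k)))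
  refine H.congr' ?_
  filter_upwards [self_mem_nhdsWithin] with s hs
  have hs' : s - t ≠ 0 := sub_ne_zero.2 hs
  have e1 : (s - t) ^ m = (s - t) ^ (m - k) * (s - t) ^ k := by
    rw [← pow_add, Nat.sub_add_cancel hkm]
  have e2 : (s - t) ^ n = (s - t) ^ (n - k) * (s - t) ^ k := by
    rw [← pow_add, Nat.sub_add_cancel hkn]
  simp only [slope_def_field, hX0, hY0, sub_zero, div_pow]
  rw [e1, e2]
  field_simp

lemma aux_nonpos (G : ℝ → ℝ) (A t : ℝ) (k : ℕ)
    (hG : Tendsto (fun s => G s / (s - t) ^ k) (𝓝[≠] t) (𝓝 A))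
    (h : ∀ᶠ s in 𝓝 t, G s ≤ 0) : A ≤ 0 := by
  have h1 : Tendsto (fun s => G s / (s - t) ^ k) (𝓝[>] t) (𝓝 A) :=
    hG.mono_left (nhdsWithin_mono _ (fun x hx => ne_of_gt hx))
  refine le_of_tendsto h1 ?_
  filter_upwards [self_mem_nhdsWithin, nhdsWithin_le_nhds h] with s hs hs2
  exact div_nonpos_of_nonpos_of_nonneg hs2 (pow_nonneg (sub_nonneg.2 (le_of_lt hs)) _)

lemma aux_odd (G : ℝ → ℝ) (A t : ℝ) (k : ℕ) (hk : Odd k)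
    (hG : Tendsto (fun s => G s / (s - t) ^ k) (𝓝[≠] t) (𝓝 A))
    (h : ∀ᶠ s in 𝓝 t, G s ≤ 0) : A = 0 := by
  refine le_antisymm (aux_nonpos G A t k hG h) ?_
  have h1 : Tendsto (fun s => G s / (s - t) ^ k) (𝓝[<] t) (𝓝 A) :=
    hG.mono_left (nhdsWithin_mono _ (fun x hx => ne_of_lt hx))
  refine ge_of_tendsto h1 ?_
  filter_upwards [self_mem_nhdsWithin, nhdsWithin_le_nhds h] with s hs hs2
  exact div_nonneg_of_nonpos hs2 (hk.pow_nonpos (sub_nonpos.2 (le_of_lt hs)))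

lemma aux_neg (G : ℝ → ℝ) (A t : ℝ) (k : ℕ)
    (hG : Tendsto (fun s => G s / (s - t) ^ k) (𝓝[≠] t) (𝓝 A)) :
    Tendsto (fun s => (-G s) / (s - t) ^ k) (𝓝[≠] t) (𝓝 (-A)) := by
  simpa only [neg_div] using hG.neg

lemma aux_lin (a b c d : ℝ) (h : (c, d) ≠ (0 : ℝ × ℝ)) (hdet : a * d = b * c) :
    ∃ r : ℝ, ((a, b) : ℝ × ℝ) = r • (c, d) := by
  by_cases hc : c = 0
  · subst hc
    have hd : d ≠ 0 := by rintro rfl; exact h rfl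
    have ha : a = 0 := by simpa [hd] using hdet
    exact ⟨b / d, by ext <;> simp [ha, hd]⟩
  · refine ⟨a / c, ?_⟩
    ext
    · simp [hc]
    · simp; field_simp; linarith

/-- For positive integers `m, n`, the function `f(x, y) = x^m - y^n` has a saddle point at
the origin if and only if both `m` and `n` are even. -/
theorem xm_sub_yn_saddle_iff (m n : ℕ) (hm : 0 < m) (hn : 0 < n) :
    HasSaddleAt Set.univ (fun q : ℝ × ℝ => q.1 ^ m - q.2 ^ n) (0, 0) ↔
      Even m ∧ Even n := by
  constructor
  · rintro ⟨a₁, b₁, a₂, b₂, t₁, t₂, γ₁, γ₂, r1, r2, ht1, ht2, p1, p2, tr, -, hmax, hmin⟩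
    obtain ⟨d1, n1⟩ := r1.2.2.2 t₁ ht1
    obtain ⟨d2, n2⟩ := r2.2.2.2 t₂ ht2
    have D1 := d1.hasDerivAt
    have D2 := d2.hasDerivAt
    generalize deriv γ₁ t₁ = v at *
    generalize deriv γ₂ t₂ = w at *
    obtain ⟨a, b⟩ := v
    obtain ⟨c, d⟩ := w
    have X1 : HasDerivAt (fun s => (γ₁ s).1) a t₁ := D1.fst
    have Y1 : HasDerivAt (fun s => (γ₁ s).2) b t₁ := D1.snd
    have X2 : HasDerivAt (fun s => (γ₂ s).1) c t₂ := D2.fst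
    have Y2 : HasDerivAt (fun s => (γ₂ s).2) d t₂ := D2.snd
    have x1 : (γ₁ t₁).1 = 0 := by rw [p1]
    have y1 : (γ₁ t₁).2 = 0 := by rw [p1]
    have x2 : (γ₂ t₂).1 = 0 := by rw [p2]
    have y2 : (γ₂ t₂).2 = 0 := by rw [p2]
    have M1 : ∀ᶠ s in 𝓝 t₁, (γ₁ s).1 ^ m - (γ₁ s).2 ^ n ≤ 0 := by
      filter_upwards [hmax] with s hs
      simpa [x1, y1, hm.ne', hn.ne'] using hs
    have M2 : ∀ᶠ s in 𝓝 t₂, -((γ₂ s).1 ^ m - (γ₂ s).2 ^ n) ≤ 0 := by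
      filter_upwards [hmin] with s hs
      simpa [x2, y2, hm.ne', hn.ne'] using hs
    have hdet : a * d ≠ b * c := fun h => by
      obtain ⟨r, hr⟩ := aux_lin a b c d n2 h
      exact tr r hr
    have T1 := fun k h h' => aux_tendsto _ _ a b t₁ X1 Y1 x1 y1 m n k h h'
    have T2 := fun k h h' => aux_neg _ _ _ _ (aux_tendsto _ _ c d t₂ X2 Y2 x2 y2 m n k h h')
    by_contra hcon
    rcases lt_trichotomy m n with hmn | hmn | hmn
    · have hz : n - m ≠ 0 := by omega
      rcases Nat.even_or_odd m with he | ho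
      · have ho : Odd n := by
          rw [← Nat.not_even_iff_odd]; exact fun h => hcon ⟨he, h⟩
        have := aux_nonpos _ _ _ _ (T1 m le_rfl hmn.le) M1
        simp [hz] at this
        have ha : a = 0 := by
          have := le_antisymm this (he.pow_nonneg a)
          exact pow_eq_zero_iff hm.ne' |>.1 this
        have hb : b = 0 := by
          have : IsLocalMin (fun s => (γ₁ s).2) t₁ := by
            filter_upwards [M1] with s hs
            rw [y1]
            exact ho.pow_nonneg_iff.1 (by linarith [he.pow_nonneg (γ₁ s).1])
          exact this.hasDerivAt_eq_zero Y1
        exact n1 (by rw [ha, hb]; rfl)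
      · have A1 := aux_odd _ _ _ _ ho (T1 m le_rfl hmn.le) M1
        have A2 := aux_odd _ _ _ _ ho (T2 m le_rfl hmn.le) M2
        simp [hz, hm.ne'] at A1 A2
        simp [A1, A2] at hdet
    · subst hmn
      have ho : Odd m := by
        rw [← Nat.not_even_iff_odd]; exact fun h => hcon ⟨h, h⟩
      have A1 := aux_odd _ _ _ _ ho (T1 m le_rfl le_rfl) M1
      have A2 := aux_odd _ _ _ _ ho (T2 m le_rfl le_rfl) M2
      simp at A1 A2
      have e1 : a = b := ho.strictMono_pow.injective (by simpa using sub_eq_zero.1 A1)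
      have e2 : c = d := ho.strictMono_pow.injective (show c ^ m = d ^ m by linarith)
      apply hdet; rw [e1, e2]
    · have hz : m - n ≠ 0 := by omega
      rcases Nat.even_or_odd n with he | ho
      · have ho : Odd m := by
          rw [← Nat.not_even_iff_odd]; exact fun h => hcon ⟨h, he⟩
        have := aux_nonpos _ _ _ _ (T2 n hmn.le le_rfl) M2
        simp [hz] at this
        have ha : d = 0 := by
          have := le_antisymm this (he.pow_nonneg d)
          exact pow_eq_zero_iff hn.ne' |>.1 this
        have hb : c = 0 := by
          have : IsLocalMin (fun s => (γ₂ s).1) t₂ := by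
            filter_upwards [M2] with s hs
            rw [x2]
            exact ho.pow_nonneg_iff.1 (by linarith [he.pow_nonneg (γ₂ s).2])
          exact this.hasDerivAt_eq_zero X2
        exact n2 (by rw [ha, hb]; rfl)
      · have A1 := aux_odd _ _ _ _ ho (T1 n hmn.le le_rfl) M1
        have A2 := aux_odd _ _ _ _ ho (T2 n hmn.le le_rfl) M2
        simp [hz, hn.ne'] at A1 A2
        simp [A1, A2] at hdet
  · rintro ⟨he, hf⟩
    have D1 : ∀ t : ℝ, HasDerivAt (fun s : ℝ => ((0 : ℝ), s)) ((0 : ℝ), (1 : ℝ)) t := fun t =>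
      (hasDerivAt_const t (0 : ℝ)).prodMk (hasDerivAt_id t)
    have D2 : ∀ t : ℝ, HasDerivAt (fun s : ℝ => (s, (0 : ℝ))) ((1 : ℝ), (0 : ℝ)) t := fun t =>
      (hasDerivAt_id t).prodMk (hasDerivAt_const t (0 : ℝ))
    refine ⟨-1, 1, -1, 1, 0, 0, fun s => (0, s), fun s => (s, 0),
      ⟨by norm_num, by fun_prop, fun _ _ => mem_univ _, fun t _ =>
        ⟨(D1 t).differentiableAt, by rw [(D1 t).deriv]; simp⟩⟩,
      ⟨by norm_num, by fun_prop, fun _ _ => mem_univ _, fun t _ =>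
        ⟨(D2 t).differentiableAt, by rw [(D2 t).deriv]; simp⟩⟩,
      by norm_num, by norm_num, rfl, rfl, ?_, ?_, ?_, ?_⟩
    · intro c; rw [(D1 0).deriv, (D2 0).deriv]; simp
    · intro c; rw [(D1 0).deriv, (D2 0).deriv]; simp
    · refine Eventually.of_forall fun s => ?_
      simpa [hm.ne', hn.ne'] using hf.pow_nonneg s
    · refine Eventually.of_forall fun s => ?_
      simpa [hm.ne', hn.ne'] using he.pow_nonneg s
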